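/- Let k be a field and n ≥ 4; work in R = k[x₁,…,xₙ]. Let a ≥ 1 be an integer. Let I_{n,a} = P₁^a ∩ P₂^a ∩ P₃^a be the ideal of three general fat points of multiplicity a in projective (n−1)-space, and let I_{n−1,a} denote the corresponding ideal of three fat points of multiplicity a formed in the variables x₁,…,x_{n−1} (i.e., the intersection of the a-th powers of the ideals generated by all of x₁,…,x_{n−1} except x₁, except x₂, and except x₃, respectively, extended to R). Then I_{n,a} = xₙ·I_{n,a−1} + I_{n−1,a}, the set of minimal monomial generators of I_{n,a} is the union of those of xₙ·I_{n,a−1} and of I_{n−1,a}, and no monomial is a minimal monomial generator of both xₙ·I_{n,a−1} and I_{n−1,a}. -/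

import Mathlib

open MvPolynomial

/-- The ideal of `R = k[x₁,…,xₙ]` generated by all the variables except `x_t`. -/
noncomputable def Pt (k : Type*) [Field k] (n : ℕ) (t : Fin n) :
    Ideal (MvPolynomial (Fin n) k) :=
  Ideal.span (X '' {i | i ≠ t})

/-- `I_{n,a,b,c} = P₁^a ∩ P₂^b ∩ P₃^c`, the defining ideal of the scheme of three general
(coordinate) fat points `{(P₁,a),(P₂,b),(P₃,c)}` in ℙ^{n-1}. -/
noncomputable def fatIdeal (k : Type*) [Field k] (n : ℕ) (hn : 4 ≤ n) (a b c : ℕ) :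
    Ideal (MvPolynomial (Fin n) k) :=
  Pt k n ⟨0, by omega⟩ ^ a ⊓ Pt k n ⟨1, by omega⟩ ^ b ⊓ Pt k n ⟨2, by omega⟩ ^ c

/-- The ideal of `R = k[x₁,…,xₙ]` generated by all the variables among `x₁,…,x_{n-1}`
except `x_t`. -/
noncomputable def Qt (k : Type*) [Field k] (n : ℕ) (t : Fin n) :
    Ideal (MvPolynomial (Fin n) k) :=
  Ideal.span (X '' {i | i ≠ t ∧ (i : ℕ) + 1 < n})

/-- `I_{n-1,a}` : the defining ideal of three general (coordinate) fat points of equal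
multiplicity `a` formed in the variables `x₁,…,x_{n-1}`, extended to `R`. -/
noncomputable def fatIdealLower (k : Type*) [Field k] (n : ℕ) (hn : 4 ≤ n) (a : ℕ) :
    Ideal (MvPolynomial (Fin n) k) :=
  Qt k n ⟨0, by omega⟩ ^ a ⊓ Qt k n ⟨1, by omega⟩ ^ a ⊓ Qt k n ⟨2, by omega⟩ ^ a

/-- The maximal homogeneous ideal `m = (x₁,…,xₙ)` of `R = k[x₁,…,xₙ]`. -/
noncomputable def maxIdeal (k : Type*) [Field k] (n : ℕ) :
    Ideal (MvPolynomial (Fin n) k) :=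
  Ideal.span (Set.range X)

/-- `u` is a monomial of `R = k[x₁,…,xₙ]`. -/
def IsMonomial {k : Type*} [Field k] {n : ℕ} (u : MvPolynomial (Fin n) k) : Prop :=
  ∃ d : Fin n →₀ ℕ, u = monomial d 1

/-- `u` is a minimal monomial generator of the monomial ideal `L`:
`u ∈ L` and `u ∉ m·L`. -/
def IsMinGen {k : Type*} [Field k] {n : ℕ} (L : Ideal (MvPolynomial (Fin n) k))
    (u : MvPolynomial (Fin n) k) : Prop :=
  u ∈ L ∧ u ∉ maxIdeal k n * L

section MonomialIdeals

variable {σ k : Type*} [Field k]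

/-- `L` consists of the polynomials all of whose exponent vectors lie in `S`. -/
def HasExponents (L : Ideal (MvPolynomial σ k)) (S : Set (σ →₀ ℕ)) : Prop :=
  ∀ f, f ∈ L ↔ ∀ d ∈ f.support, d ∈ S

namespace HasExponents

variable {L M : Ideal (MvPolynomial σ k)} {S T : Set (σ →₀ ℕ)}

lemma monomial_mem_iff (h : HasExponents L S) (d : σ →₀ ℕ) :
    monomial d (1 : k) ∈ L ↔ d ∈ S := by
  classical
  rw [h]
  simp [support_monomial]

lemma add_mem (h : HasExponents L S) {d : σ →₀ ℕ} (hd : d ∈ S) (c : σ →₀ ℕ) : d + c ∈ S := by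
  rw [← h.monomial_mem_iff] at hd ⊢
  have := L.mul_mem_right (monomial c (1 : k)) hd
  simpa [monomial_mul] using this

lemma of_span (hS : ∀ d ∈ S, ∀ c, d + c ∈ S) :
    HasExponents (Ideal.span ((fun d => monomial d (1 : k)) '' S)) S := by
  intro f
  rw [mem_ideal_span_monomial_image]
  refine forall₂_congr fun d _ => ⟨?_, fun hd => ⟨d, hd, le_rfl⟩⟩
  rintro ⟨e, he, hle⟩
  obtain ⟨c, rfl⟩ := exists_add_of_le hle
  exact hS e he c

lemma eq_span (h : HasExponents L S) :
    L = Ideal.span ((fun d => monomial d (1 : k)) '' S) := by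
  ext f
  rw [h f, of_span (fun d hd c => h.add_mem hd c) f]

lemma inf (hL : HasExponents L S) (hM : HasExponents M T) : HasExponents (L ⊓ M) (S ∩ T) := by
  intro f
  rw [Ideal.mem_inf, hL, hM]
  simp only [Set.mem_inter_iff, forall_and]

lemma eq_sup {N : Ideal (MvPolynomial σ k)} (hN : HasExponents N (S ∪ T))
    (hL : HasExponents L S) (hM : HasExponents M T) : N = L ⊔ M := by
  rw [hN.eq_span, Set.image_union, Ideal.span_union, ← hL.eq_span, ← hM.eq_span]

lemma span_X_mul (h : HasExponents L S) (s : Set σ) :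
    HasExponents (Ideal.span (X '' s) * L)
      {d | ∃ i ∈ s, ∃ e ∈ S, d = e + Finsupp.single i 1} := by
  have key : Ideal.span (X '' s) * L = Ideal.span ((fun d => monomial d (1 : k)) ''
      {d | ∃ i ∈ s, ∃ e ∈ S, d = e + Finsupp.single i 1}) := by
    conv_lhs => rw [h.eq_span, Ideal.span_mul_span']
    congr 1
    ext f
    simp only [Set.mem_mul, Set.mem_image, Set.mem_ofPred_eq]
    constructor
    · rintro ⟨_, ⟨i, hi, rfl⟩, _, ⟨e, he, rfl⟩, rfl⟩
      exact ⟨_, ⟨i, hi, e, he, rfl⟩, by simp [X, monomial_mul, add_comm]⟩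
    · rintro ⟨_, ⟨i, hi, e, he, rfl⟩, rfl⟩
      exact ⟨_, ⟨i, hi, rfl⟩, _, ⟨e, he, rfl⟩, by simp [X, monomial_mul, add_comm]⟩
  rw [key]
  apply of_span
  rintro _ ⟨i, hi, e, he, rfl⟩ c
  exact ⟨i, hi, e + c, h.add_mem he c, add_right_comm _ _ _⟩

end HasExponents

lemma sum_add_single [DecidableEq σ] (s : Finset σ) (d : σ →₀ ℕ) (i : σ) :
    ∑ j ∈ s, (d + Finsupp.single i 1 : σ →₀ ℕ) j = ∑ j ∈ s, d j + if i ∈ s then 1 else 0 := by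
  simp [Finset.sum_add_distrib, Finsupp.single_apply]

lemma exists_eq_add_single {d : σ →₀ ℕ} {i : σ} (h : d i ≠ 0) :
    ∃ e : σ →₀ ℕ, d = e + Finsupp.single i 1 := by
  classical
  refine ⟨d - Finsupp.single i 1, (tsub_add_cancel_of_le ?_).symm⟩
  simpa using Nat.one_le_iff_ne_zero.mpr h

lemma hasExponents_span_X_pow (s : Finset σ) (a : ℕ) :
    HasExponents (Ideal.span ((X : σ → MvPolynomial σ k) '' s) ^ a)
      {d | a ≤ ∑ i ∈ s, d i} := by
  classical
  induction a with
  | zero => intro f; simp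
  | succ a ih =>
    rw [pow_succ']
    convert ih.span_X_mul (s : Set σ) using 1
    ext d
    simp only [Set.mem_ofPred_eq, Finset.mem_coe]
    constructor
    · intro h
      obtain ⟨i, hi, hne⟩ := Finset.exists_ne_zero_of_sum_ne_zero (by omega : ∑ i ∈ s, d i ≠ 0)
      obtain ⟨e, rfl⟩ := exists_eq_add_single hne
      rw [sum_add_single, if_pos hi] at h
      exact ⟨i, hi, e, by omega, rfl⟩
    · rintro ⟨i, hi, e, he, rfl⟩
      rw [sum_add_single, if_pos hi]
      omega

end MonomialIdeals

section FatPoints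

variable {k : Type*} [Field k] {n : ℕ}

/-- `d` is a minimal element of the upper set `S` of exponents. -/
def IsMinExponent (S : Set (Fin n →₀ ℕ)) (d : Fin n →₀ ℕ) : Prop :=
  d ∈ S ∧ ∀ i e, d = e + Finsupp.single i 1 → e ∉ S

lemma HasExponents.isMinGen_monomial_iff {L : Ideal (MvPolynomial (Fin n) k)}
    {S : Set (Fin n →₀ ℕ)} (h : HasExponents L S) (d : Fin n →₀ ℕ) :
    IsMinGen L (monomial d 1) ↔ IsMinExponent S d := by
  unfold IsMinGen IsMinExponent maxIdeal
  rw [h.monomial_mem_iff, ← Set.image_univ, (h.span_X_mul Set.univ).monomial_mem_iff]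
  simp only [Set.mem_univ, true_and, Set.mem_ofPred_eq]
  grind

/-- The degree of `x^d` in the variables other than `x_t`. -/
def degreeOff (t : Fin n) (d : Fin n →₀ ℕ) : ℕ := ∑ i with i ≠ t, d i

/-- The degree of `x^d` in the variables other than `x_t` and the last one. -/
def degreeOffLast (t : Fin n) (d : Fin n →₀ ℕ) : ℕ := ∑ i with i ≠ t ∧ (i : ℕ) + 1 < n, d i

lemma degreeOff_add_single (t i : Fin n) (d : Fin n →₀ ℕ) :
    degreeOff t (d + Finsupp.single i 1) = degreeOff t d + if i ≠ t then 1 else 0 := by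
  rw [degreeOff, sum_add_single]
  simp [degreeOff]

lemma degreeOff_eq_degreeOffLast_add {t l : Fin n} (hl : (l : ℕ) + 1 = n) (ht : t ≠ l)
    (d : Fin n →₀ ℕ) : degreeOff t d = degreeOffLast t d + d l := by
  have : Finset.univ.filter (fun i : Fin n => i ≠ t)
      = insert l (Finset.univ.filter fun i : Fin n => i ≠ t ∧ (i : ℕ) + 1 < n) := by
    ext i
    simp only [Finset.mem_filter, Finset.mem_univ, true_and, Finset.mem_insert, Fin.ext_iff,
      ne_eq] at ht ⊢
    omega
  rw [degreeOff, degreeOffLast, this, Finset.sum_insert (by simp [hl]), add_comm]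

/-- The exponents of the ideal of fat points of multiplicity `a` at the points indexed by `s`. -/
def fatExponents (s : Set (Fin n)) (a : ℕ) : Set (Fin n →₀ ℕ) :=
  {d | ∀ t ∈ s, a ≤ degreeOff t d}

/-- The exponents of the ideal of fat points of multiplicity `a` at the points indexed by `s`,
formed without the last variable. -/
def fatExponentsLower (s : Set (Fin n)) (a : ℕ) : Set (Fin n →₀ ℕ) :=
  {d | ∀ t ∈ s, a ≤ degreeOffLast t d}

lemma hasExponents_Pt_pow (t : Fin n) (a : ℕ) :
    HasExponents (Pt k n t ^ a) {d | a ≤ degreeOff t d} := by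
  simpa [Pt, degreeOff] using
    hasExponents_span_X_pow (k := k) (Finset.univ.filter fun i : Fin n => i ≠ t) a

lemma hasExponents_Qt_pow (t : Fin n) (a : ℕ) :
    HasExponents (Qt k n t ^ a) {d | a ≤ degreeOffLast t d} := by
  simpa [Qt, degreeOffLast] using hasExponents_span_X_pow (k := k)
    (Finset.univ.filter fun i : Fin n => i ≠ t ∧ (i : ℕ) + 1 < n) a

lemma hasExponents_fatIdeal (hn : 4 ≤ n) (a : ℕ) :
    HasExponents (fatIdeal k n hn a a a)
      (fatExponents {⟨0, by omega⟩, ⟨1, by omega⟩, ⟨2, by omega⟩} a) := by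
  have h (t₁ t₂ t₃ : Fin n) : fatExponents {t₁, t₂, t₃} a = {d | a ≤ degreeOff t₁ d} ∩
      {d | a ≤ degreeOff t₂ d} ∩ {d | a ≤ degreeOff t₃ d} := by
    ext d
    simp [fatExponents, and_assoc]
  rw [h]
  exact ((hasExponents_Pt_pow _ a).inf (hasExponents_Pt_pow _ a)).inf (hasExponents_Pt_pow _ a)

lemma hasExponents_fatIdealLower (hn : 4 ≤ n) (a : ℕ) :
    HasExponents (fatIdealLower k n hn a)
      (fatExponentsLower {⟨0, by omega⟩, ⟨1, by omega⟩, ⟨2, by omega⟩} a) := by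
  have h (t₁ t₂ t₃ : Fin n) : fatExponentsLower {t₁, t₂, t₃} a = {d | a ≤ degreeOffLast t₁ d} ∩
      {d | a ≤ degreeOffLast t₂ d} ∩ {d | a ≤ degreeOffLast t₃ d} := by
    ext d
    simp [fatExponentsLower, and_assoc]
  rw [h]
  exact ((hasExponents_Qt_pow _ a).inf (hasExponents_Qt_pow _ a)).inf (hasExponents_Qt_pow _ a)

variable {s : Set (Fin n)} {l : Fin n} {a : ℕ} {d e : Fin n →₀ ℕ}

lemma mem_fatExponents_succ_iff (hl : l ∉ s) :
    e + Finsupp.single l 1 ∈ fatExponents s (a + 1) ↔ e ∈ fatExponents s a := by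
  refine forall₂_congr fun t ht => ?_
  rw [degreeOff_add_single, if_pos (by rintro rfl; exact hl ht)]
  omega

lemma mem_fatExponentsLower_iff_of_eq_zero (hln : (l : ℕ) + 1 = n) (hl : l ∉ s) (hd : d l = 0) :
    d ∈ fatExponentsLower s a ↔ d ∈ fatExponents s a := by
  refine forall₂_congr fun t ht => ?_
  rw [degreeOff_eq_degreeOffLast_add hln (by rintro rfl; exact hl ht), hd, add_zero]

lemma fatExponentsLower_subset (hln : (l : ℕ) + 1 = n) (hl : l ∉ s) :
    fatExponentsLower s a ⊆ fatExponents s a := by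
  intro d hd t ht
  rw [degreeOff_eq_degreeOffLast_add hln (by rintro rfl; exact hl ht)]
  exact (hd t ht).trans (Nat.le_add_right _ _)

lemma add_single_last_mem_fatExponentsLower_iff (hln : (l : ℕ) + 1 = n) :
    e + Finsupp.single l 1 ∈ fatExponentsLower s a ↔ e ∈ fatExponentsLower s a := by
  refine forall₂_congr fun t _ => ?_
  rw [degreeOffLast, sum_add_single]
  simp [degreeOffLast, hln]

/-- An element `e` of `fatExponents s a` with `e l = 0` can be lowered at some entry other than
the `l`-th, and the result multiplied by `x_l` still lies in `fatExponents s a`. -/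
lemma exists_exchange (ha : 1 ≤ a) (hs : s.Nonempty) (hl : l ∉ s)
    (he : e ∈ fatExponents s a) (hel : e l = 0) :
    ∃ i c, i ≠ l ∧ e = c + Finsupp.single i 1 ∧
      c + Finsupp.single l 1 ∈ fatExponents s a := by
  obtain ⟨t, ht⟩ := hs
  have h1 : degreeOff t e ≠ 0 := by have := he t ht; omega
  obtain ⟨i, -, hi⟩ := Finset.exists_ne_zero_of_sum_ne_zero h1
  obtain ⟨c, rfl⟩ := exists_eq_add_single hi
  refine ⟨i, c, by rintro rfl; exact hi hel, rfl, fun u hu => ?_⟩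
  have h2 := he u hu
  rw [degreeOff_add_single] at h2 ⊢
  rw [if_pos (by rintro rfl; exact hl hu)]
  split_ifs at h2 <;> omega

lemma mul_last_exponents_eq (hl : l ∉ s) (ha : 1 ≤ a) :
    {d | ∃ i ∈ ({l} : Set (Fin n)), ∃ e ∈ fatExponents s (a - 1), d = e + Finsupp.single i 1}
      = {d | d ∈ fatExponents s a ∧ d l ≠ 0} := by
  obtain ⟨b, rfl⟩ := Nat.exists_eq_add_of_le' ha
  ext d
  simp only [Set.mem_singleton_iff, exists_eq_left, Set.mem_ofPred_eq, Nat.add_sub_cancel]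
  constructor
  · rintro ⟨e, he, rfl⟩
    exact ⟨(mem_fatExponents_succ_iff hl).mpr he, by simp⟩
  · rintro ⟨hd, hdl⟩
    obtain ⟨e, rfl⟩ := exists_eq_add_single hdl
    exact ⟨e, (mem_fatExponents_succ_iff hl).mp hd, rfl⟩

lemma fatExponents_eq_union (hln : (l : ℕ) + 1 = n) (hl : l ∉ s) :
    fatExponents s a = {d | d ∈ fatExponents s a ∧ d l ≠ 0} ∪ fatExponentsLower s a := by
  ext d
  refine ⟨fun hd => ?_, fun h => h.elim And.left fun h => fatExponentsLower_subset hln hl h⟩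
  by_cases h : d l = 0
  · exact .inr ((mem_fatExponentsLower_iff_of_eq_zero hln hl h).mpr hd)
  · exact .inl ⟨hd, h⟩

lemma isMinExponent_last_iff (hs : s.Nonempty) (hl : l ∉ s) (ha : 1 ≤ a) :
    IsMinExponent {d | d ∈ fatExponents s a ∧ d l ≠ 0} d ↔
      IsMinExponent (fatExponents s a) d ∧ d l ≠ 0 := by
  constructor
  · rintro ⟨⟨hd, hdl⟩, hmin⟩
    refine ⟨⟨hd, ?_⟩, hdl⟩
    rintro i e rfl he
    have hel : e l = 0 := by
      by_contra h
      exact hmin i e rfl ⟨he, h⟩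
    obtain rfl : i = l := by
      by_contra h
      exact hdl (by simp [hel, h])
    obtain ⟨j, c, -, rfl, hc⟩ := exists_exchange ha hs hl he hel
    exact hmin j _ (add_right_comm _ _ _) ⟨hc, by simp⟩
  · rintro ⟨⟨hd, hmin⟩, hdl⟩
    exact ⟨⟨hd, hdl⟩, fun i e h he => hmin i e h he.1⟩

lemma isMinExponent_lower_iff (hln : (l : ℕ) + 1 = n) (hl : l ∉ s) :
    IsMinExponent (fatExponentsLower s a) d ↔
      IsMinExponent (fatExponents s a) d ∧ d l = 0 := by
  constructor
  · rintro ⟨hd, hmin⟩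
    have hdl : d l = 0 := by
      by_contra h
      obtain ⟨e, rfl⟩ := exists_eq_add_single h
      exact hmin l e rfl ((add_single_last_mem_fatExponentsLower_iff hln).mp hd)
    refine ⟨⟨fatExponentsLower_subset hln hl hd, ?_⟩, hdl⟩
    rintro i e rfl he
    have hel : e l = 0 := (Nat.add_eq_zero_iff.mp hdl).1
    exact hmin i e rfl ((mem_fatExponentsLower_iff_of_eq_zero hln hl hel).mpr he)
  · rintro ⟨⟨hd, hmin⟩, hdl⟩
    exact ⟨(mem_fatExponentsLower_iff_of_eq_zero hln hl hdl).mpr hd,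
      fun i e h he => hmin i e h (fatExponentsLower_subset hln hl he)⟩

end FatPoints

/-- For `a ≥ 1`, one has `I_{n,a} = xₙ · I_{n,a-1} + I_{n-1,a}`, the set
of minimal monomial generators of `I_{n,a}` is the union of those of `xₙ · I_{n,a-1}` and
of `I_{n-1,a}`, and no monomial is a minimal monomial generator of both. -/
theorem fatIdeal_equal_multiplicity_splitting (k : Type*) [Field k] (n : ℕ) (hn : 4 ≤ n)
    (a : ℕ) (ha : 1 ≤ a) :
    fatIdeal k n hn a a a
      = Ideal.span {(X (⟨n - 1, by omega⟩ : Fin n) : MvPolynomial (Fin n) k)}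
          * fatIdeal k n hn (a - 1) (a - 1) (a - 1)
        + fatIdealLower k n hn a
    ∧ (∀ u : MvPolynomial (Fin n) k, IsMonomial u →
        (IsMinGen (fatIdeal k n hn a a a) u ↔
          IsMinGen (Ideal.span {(X (⟨n - 1, by omega⟩ : Fin n) : MvPolynomial (Fin n) k)}
              * fatIdeal k n hn (a - 1) (a - 1) (a - 1)) u
          ∨ IsMinGen (fatIdealLower k n hn a) u))
    ∧ (∀ u : MvPolynomial (Fin n) k, IsMonomial u →
        ¬ (IsMinGen (Ideal.span {(X (⟨n - 1, by omega⟩ : Fin n) : MvPolynomial (Fin n) k)}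
              * fatIdeal k n hn (a - 1) (a - 1) (a - 1)) u
           ∧ IsMinGen (fatIdealLower k n hn a) u)) := by
  let l : Fin n := ⟨n - 1, by omega⟩
  let s : Set (Fin n) := {⟨0, by omega⟩, ⟨1, by omega⟩, ⟨2, by omega⟩}
  have hln : (l : ℕ) + 1 = n := by simp only [l]; omega
  have hl : l ∉ s := by
    simp only [l, s, Set.mem_insert_iff, Set.mem_singleton_iff, Fin.mk.injEq]
    omega
  have hs : s.Nonempty := ⟨_, Set.mem_insert _ _⟩
  have hI : HasExponents (fatIdeal k n hn a a a) (fatExponents s a) := hasExponents_fatIdeal hn a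
  have hB : HasExponents (fatIdealLower k n hn a) (fatExponentsLower s a) :=
    hasExponents_fatIdealLower hn a
  have hA : HasExponents (Ideal.span {(X l : MvPolynomial (Fin n) k)}
      * fatIdeal k n hn (a - 1) (a - 1) (a - 1)) {d | d ∈ fatExponents s a ∧ d l ≠ 0} := by
    have := (hasExponents_fatIdeal (k := k) hn (a - 1)).span_X_mul {l}
    rwa [Set.image_singleton, mul_last_exponents_eq hl ha] at this
  have hminI := hI.isMinGen_monomial_iff
  have hminA (d) := (hA.isMinGen_monomial_iff d).trans (isMinExponent_last_iff hs hl ha)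
  have hminB (d) := (hB.isMinGen_monomial_iff d).trans (isMinExponent_lower_iff hln hl)
  refine ⟨?_, ?_, ?_⟩
  · rw [fatExponents_eq_union hln hl] at hI
    exact hI.eq_sup hA hB
  · rintro _ ⟨d, rfl⟩
    rw [hminI, hminA, hminB]
    tauto
  · rintro _ ⟨d, rfl⟩
    rw [hminA, hminB]
    tauto
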